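/- Let T be a minimal interval exchange transformation that is not of rotation type, and suppose that the lengths λ_1,...,λ_m of the subintervals exchanged by T are linearly independent over ℚ. Then T does not have an n-th root in the group 𝔾 of interval exchange transformations for any n ≥ 2; that is, there is no IET S and integer n ≥ 2 with S^n = T. -/

import Mathlib

open Set

namespace IETRoots

noncomputable section

/-- The unit interval `[0,1)`, the domain of our interval exchange transformations. -/
def unitI : Set ℝ := Set.Ico 0 1

/-- `T : ℝ → ℝ` is (the extension by the identity of) an interval exchange
transformation: it fixes the complement of `[0,1)`, maps `[0,1)` bijectively onto
itself, and there is a finite partition of `[0,1)` into half-open intervals on each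
of which `T` is a translation.  The group `𝔾` of IETs is the set of such maps under
composition. -/
def IsIET (T : ℝ → ℝ) : Prop :=
  Set.BijOn T unitI unitI ∧ (∀ x, x ∉ unitI → T x = x) ∧
  ∃ (k : ℕ) (β : Fin (k + 1) → ℝ), StrictMono β ∧ β 0 = 0 ∧ β (Fin.last k) = 1 ∧
    ∀ i : Fin k, ∃ c : ℝ, ∀ x ∈ Set.Ico (β i.castSucc) (β i.succ), T x = x + c

/-- The `ℤ`-orbit `{T^n x : n ∈ ℤ}` of `x` under the bijection `T`. -/
def orbitZ (T : ℝ → ℝ) (x : ℝ) : Set ℝ := {y | ∃ n : ℕ, T^[n] x = y ∨ T^[n] y = x}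

/-- `T` is minimal: every orbit is dense in `[0,1)`. -/
def IsMinimal (T : ℝ → ℝ) : Prop := ∀ x ∈ unitI, unitI ⊆ closure (orbitZ T x)

/-- `T` is of rotation type: `T x = x + α (mod 1)` on `[0,1)`. -/
def IsRotationType (T : ℝ → ℝ) : Prop := ∃ α : ℝ, ∀ x ∈ unitI, T x = Int.fract (x + α)

/-- `T` has an `n`-th root in the group `𝔾` of IETs for some `n ≥ 2`. -/
def HasNontrivialRoot (T : ℝ → ℝ) : Prop :=
  ∃ (S : ℝ → ℝ) (n : ℕ), IsIET S ∧ 2 ≤ n ∧ S^[n] = T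

/-- The set `D(T)` of points of `[0,1)` at which `T` is discontinuous
(as a map of `[0,1)`). -/
def DiscSet (T : ℝ → ℝ) : Set ℝ := {x | x ∈ unitI ∧ ¬ ContinuousWithinAt T unitI x}

/-- `β_j = λ_1 + ⋯ + λ_j` (`0`-indexed: the sum of the first `j` lengths). -/
def betaPt {m : ℕ} (lam : Fin m → ℝ) (j : ℕ) : ℝ :=
  ∑ i ∈ Finset.univ.filter (fun i : Fin m => (i : ℕ) < j), lam i

/-- The interval exchange transformation `T_{(π,λ)}` determined by a permutation
`π ∈ S_m` and a length vector `λ`: on `I_j = [β_{j-1}, β_j)` it is given by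
`x ↦ x - ∑_{i<j} λ_i + ∑_{π(i)<π(j)} λ_i`; outside `[0,1)` it is the identity. -/
noncomputable def ietMap {m : ℕ} (π : Equiv.Perm (Fin m)) (lam : Fin m → ℝ) : ℝ → ℝ :=
  fun x =>
    if h : ∃ j : Fin m, x ∈ Set.Ico (betaPt lam (j : ℕ)) (betaPt lam (j : ℕ) + lam j) then
      x - betaPt lam (h.choose : ℕ) +
        ∑ i ∈ Finset.univ.filter (fun i : Fin m => π i < π h.choose), lam i
    else x

/-- A permutation `π ∈ S_m` is separating if `π(i+1) ≠ π(i) + 1` for `1 ≤ i ≤ m-1`. -/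
def Separating {m : ℕ} (π : Equiv.Perm (Fin m)) : Prop :=
  ∀ i j : Fin m, (j : ℕ) = (i : ℕ) + 1 → (π j : ℕ) ≠ (π i : ℕ) + 1

/-- A permutation `π ∈ S_m` is irreducible if `π({1,…,k}) ≠ {1,…,k}` for all `k < m`. -/
def IrreduciblePerm {m : ℕ} (π : Equiv.Perm (Fin m)) : Prop :=
  ∀ k : ℕ, 1 ≤ k → k < m → ∃ i : Fin m, (i : ℕ) < k ∧ k ≤ (π i : ℕ)

/-- The endpoints `0 = γ_0 < γ_1 < ⋯ < γ_{m-1} < γ_m = 1`, namely the discontinuities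
of `T` together with `0` and `1`. -/
def endpointsOf (T : ℝ → ℝ) : Set ℝ := insert 0 (insert 1 (DiscSet T))

/-- The set of lengths `l_j = γ_j - γ_{j-1}` of the intervals of continuity of `T`,
i.e. the gaps between consecutive endpoints. -/
def gapLengths (T : ℝ → ℝ) : Set ℝ :=
  {l | ∃ a ∈ endpointsOf T, ∃ b ∈ endpointsOf T,
        a < b ∧ (∀ c ∈ endpointsOf T, ¬(a < c ∧ c < b)) ∧ l = b - a}

/-- The rank of `T`: the dimension of the `ℚ`-vector space spanned by the lengths
`l_1, …, l_m`. -/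
noncomputable def ietRank (T : ℝ → ℝ) : ℕ :=
  Module.finrank ℚ (Submodule.span ℚ (gapLengths T))

/-- Keane's infinite distinct orbit condition for an `m`-IET `T = T_{(π,λ)}`:
the orbits of `β_1, …, β_{m-1}` are infinite and pairwise disjoint. -/
def SatisfiesIDOC {m : ℕ} (lam : Fin m → ℝ) (T : ℝ → ℝ) : Prop :=
  (∀ j : ℕ, 1 ≤ j → j ≤ m - 1 → (orbitZ T (betaPt lam j)).Infinite) ∧
  ∀ j j' : ℕ, 1 ≤ j → j ≤ m - 1 → 1 ≤ j' → j' ≤ m - 1 → j ≠ j' →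
    orbitZ T (betaPt lam j) ∩ orbitZ T (betaPt lam j') = ∅

/-- A rotation: a `2`-IET with permutation `(21)`, i.e. `x ↦ x + α (mod 1)`
with `α ∈ (0,1)`. -/
def IsRotation (S : ℝ → ℝ) : Prop :=
  (∀ x, x ∉ unitI → S x = x) ∧ ∃ α ∈ Set.Ioo (0 : ℝ) 1, ∀ x ∈ unitI, S x = Int.fract (x + α)

/-- Conjugacy in the group `𝔾` of IETs. -/
def IsConjugate (T T' : ℝ → ℝ) : Prop := ∃ g : ℝ → ℝ, IsIET g ∧ g ∘ T = T' ∘ g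

/-- `T` is a tower of type `(n_1, …, n_k)` over the `k`-IET `S`:  there is a partition
`0 = t_0 < t_1 < ⋯ < t_k = 1` into intervals `I_i` on which `S` is a translation, a
scaling factor `c > 0`, and for each `i` a family of `n_i` pairwise disjoint "levels"
(scaled copies of `I_i`) which together partition `[0,1)`, such that `T` translates each
level of the `i`-th column onto the next one, and maps the top level back to the bottom
levels according to `S` (all after rescaling by `c`). -/
def IsTowerOver {k : ℕ} (T : ℝ → ℝ) (n : Fin k → ℕ) (S : ℝ → ℝ) : Prop :=
  IsIET T ∧ IsIET S ∧ (∀ i, 0 < n i) ∧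
  ∃ (t : Fin (k + 1) → ℝ) (c : ℝ) (a : Fin k → ℕ → ℝ),
    StrictMono t ∧ t 0 = 0 ∧ t (Fin.last k) = 1 ∧ 0 < c ∧
    (∀ i : Fin k, ∃ d : ℝ, ∀ x ∈ Set.Ico (t i.castSucc) (t i.succ), S x = x + d) ∧
    (∀ i : Fin k, ∀ j : ℕ, j < n i →
      Set.Ico (a i j) (a i j + c * (t i.succ - t i.castSucc)) ⊆ unitI) ∧
    (∀ i i' : Fin k, ∀ j j' : ℕ, j < n i → j' < n i' → (i, j) ≠ (i', j') →
      Disjoint (Set.Ico (a i j) (a i j + c * (t i.succ - t i.castSucc)))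
        (Set.Ico (a i' j') (a i' j' + c * (t i'.succ - t i'.castSucc)))) ∧
    (∀ y ∈ unitI, ∃ (i : Fin k) (j : ℕ), j < n i ∧
      y ∈ Set.Ico (a i j) (a i j + c * (t i.succ - t i.castSucc))) ∧
    (∀ i : Fin k, ∀ j : ℕ, j + 1 < n i → ∀ x ∈ Set.Ico (t i.castSucc) (t i.succ),
      T (a i j + c * (x - t i.castSucc)) = a i (j + 1) + c * (x - t i.castSucc)) ∧
    (∀ i : Fin k, ∀ x ∈ Set.Ico (t i.castSucc) (t i.succ), ∀ i' : Fin k,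
      S x ∈ Set.Ico (t i'.castSucc) (t i'.succ) →
      T (a i (n i - 1) + c * (x - t i.castSucc)) = a i' 0 + c * (S x - t i'.castSucc))

/-- The data of the first return map of `T` to `J = [a,b)`: a partition
`a = s_0 < s_1 < ⋯ < s_k = b` of `J`, return times `mt_i ≥ 1` and translation
constants `c_i` such that for `x` in the `i`-th piece the iterates `T^j x`, `0 < j < mt_i`,
avoid `J`, while `T^{mt_i} x = x + c_i ∈ J`.  Thus the first return map `T_J` is the
`k`-IET `x ↦ x + c_i` on the `i`-th piece. -/
def IsFirstReturnSystem (T : ℝ → ℝ) (a b : ℝ) {k : ℕ} (s : Fin (k + 1) → ℝ)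
    (mt : Fin k → ℕ) (c : Fin k → ℝ) : Prop :=
  StrictMono s ∧ s 0 = a ∧ s (Fin.last k) = b ∧
  ∀ i : Fin k, 0 < mt i ∧ ∀ x ∈ Set.Ico (s i.castSucc) (s i.succ),
    (∀ j : ℕ, 0 < j → j < mt i → T^[j] x ∉ Set.Ico a b) ∧
    T^[mt i] x ∈ Set.Ico a b ∧ T^[mt i] x = x + c i

/-- A finite sequence `x_0, …, x_k` is an `S`-chain if `x_0` and `x_k` lie in
`D(S) ∪ {0}` and `S x_i = x_{i+1}`. -/
def IsSChainSeq (S : ℝ → ℝ) {k : ℕ} (x : Fin (k + 1) → ℝ) : Prop :=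
  x 0 ∈ insert (0 : ℝ) (DiscSet S) ∧ x (Fin.last k) ∈ insert (0 : ℝ) (DiscSet S) ∧
  ∀ i : Fin k, S (x i.castSucc) = x i.succ

/-- A set `C ⊆ ℝ` is (the underlying set of) an `S`-chain. -/
def IsSChain (S : ℝ → ℝ) (C : Set ℝ) : Prop :=
  ∃ (k : ℕ) (x : Fin (k + 1) → ℝ), IsSChainSeq S x ∧ C = Set.range x

/-- A maximal `S`-chain: an `S`-chain which is not a proper subset of another `S`-chain. -/
def IsMaximalSChain (S : ℝ → ℝ) (C : Set ℝ) : Prop :=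
  IsSChain S C ∧ ∀ C', IsSChain S C' → C ⊆ C' → C = C'

/-- The open simplex `Δ_m ⊆ ℝ^m`. -/
def simplexSet (m : ℕ) : Set (Fin m → ℝ) := {lam | (∀ i, 0 < lam i) ∧ ∑ i, lam i = 1}

/-- The affine chart identifying (a superset of) `Δ_m` with a subset of `ℝ^{m-1}`:
`λ_i = x_i` for `i < m-1` and `λ_{m-1} = 1 - ∑ x_j`.  Lebesgue measure on `Δ_m`
is the `(m-1)`-dimensional Lebesgue measure carried through this chart. -/
def chartMap (m : ℕ) (x : Fin (m - 1) → ℝ) : Fin m → ℝ := fun i =>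
  if h : (i : ℕ) < m - 1 then x ⟨(i : ℕ), h⟩ else 1 - ∑ j, x j

/-- The permutation `(321) ∈ S_3`, sending `1 ↦ 3`, `2 ↦ 2`, `3 ↦ 1`. -/
def perm321 : Equiv.Perm (Fin 3) :=
  ⟨fun i => i.rev, fun i => i.rev, fun i => Fin.rev_rev i, fun i => Fin.rev_rev i⟩

end


/-- `f` is locally a translation to the left of `x`, compatibly with its value at `x`. -/
def LC (f : ℝ → ℝ) (x : ℝ) : Prop := ∃ δ > 0, ∀ ε, 0 < ε → ε < δ → f (x - ε) = f x - ε

theorem LC.comp {f g : ℝ → ℝ} {x : ℝ} (hf : LC f x) (hg : LC g (f x)) : LC (g ∘ f) x := by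
  obtain ⟨d, hd, h⟩ := hf
  obtain ⟨e, he, h'⟩ := hg
  refine ⟨min d e, lt_min hd he, fun ε h0 h1 => ?_⟩
  simp only [Function.comp]
  rw [h ε h0 (h1.trans_le (min_le_left _ _)), h' ε h0 (h1.trans_le (min_le_right _ _))]

theorem LC.inv {T : Equiv.Perm ℝ} {x : ℝ} (h : LC T x) : LC (T⁻¹ : Equiv.Perm ℝ) (T x) := by
  obtain ⟨d, hd, h⟩ := h
  refine ⟨d, hd, fun ε h0 h1 => ?_⟩
  rw [← h ε h0 h1]
  simp

theorem LC.id' (x : ℝ) : LC (fun x => x) x := ⟨1, one_pos, fun _ _ _ => rfl⟩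

theorem LC_pow {T : Equiv.Perm ℝ} {x : ℝ} (k : ℕ) (h : ∀ l < k, LC T ((T ^ l) x)) :
    LC (T ^ k : Equiv.Perm ℝ) x := by
  induction k with
  | zero => exact LC.id' x
  | succ k ih =>
    have := (ih (fun l hl => h l (by omega))).comp (h k (by omega))
    rw [pow_succ']
    exact this

theorem mem_pow_iff {L : AddSubgroup ℝ} {T : Equiv.Perm ℝ} (hTL : ∀ x, T x - x ∈ L) (k : ℤ) (x : ℝ) :
    (T ^ k) x ∈ L ↔ x ∈ L := by
  have step : ∀ y, T y ∈ L ↔ y ∈ L := fun y => by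
    constructor
    · intro h
      have := L.sub_mem h (hTL y)
      simpa using this
    · intro h
      have := L.add_mem (hTL y) h
      simpa using this
  induction k using Int.induction_on with
  | zero => simp
  | succ k ih =>
    rw [add_comm, zpow_add, zpow_one, Equiv.Perm.mul_apply, step]
    exact ih
  | pred k ih =>
    refine Iff.trans ?_ ih
    rw [← step]
    have : T ((T ^ (-(k:ℤ) - 1)) x) = (T ^ (-(k:ℤ))) x := by
      rw [← Equiv.Perm.mul_apply, ← zpow_one_add]; congr 2; ring
    rw [this]

/-- LC for iterates at points outside `L`. -/
theorem LC_pow_of_notMem {L : AddSubgroup ℝ} {T : Equiv.Perm ℝ} (hTL : ∀ x, T x - x ∈ L)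
    (hLC : ∀ x, x ∉ L → LC T x) (k : ℕ) {x : ℝ} (hx : x ∉ L) : LC (T ^ k : Equiv.Perm ℝ) x := by
  apply LC_pow
  intro l _
  apply hLC
  have := mem_pow_iff hTL l x
  rw [zpow_natCast] at this
  rwa [this]

theorem exists_notMem {T : Equiv.Perm ℝ} {x : ℝ} (hinj : Function.Injective (fun k : ℤ => (T ^ k) x))
    {F : Set ℝ} (hF : F.Finite) {s : ℤ} (hs : s ≠ 0) : ∃ k : ℕ, 1 ≤ k ∧ (T ^ (s * k)) x ∉ F := by
  by_contra! h
  have hinj2 : Function.Injective (fun k : ℕ => (T ^ (s * ((k + 1 : ℕ) : ℤ))) x) := by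
    intro a b hab
    have := hinj hab
    have := mul_left_cancel₀ hs this
    have : a + 1 = b + 1 := by exact_mod_cast this
    omega
  exact Set.infinite_of_injective_forall_mem hinj2 (fun k => h (k + 1) (by omega)) hF

theorem S_special_mem {L : AddSubgroup ℝ} {T S : Equiv.Perm ℝ} (hcomm : Commute S T)
    (hTL : ∀ x, T x - x ∈ L) (hLC : ∀ x, x ∉ L → LC T x)
    {F : Set ℝ} (hF : F.Finite) (hSF : ∀ x, x ∉ F → LC S x) {x : ℝ}
    (hinj : Function.Injective (fun k : ℤ => (T ^ k) x))
    (hback : ∀ k : ℕ, LC ((T ^ k)⁻¹ : Equiv.Perm ℝ) x)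
    (hforw : ∀ k : ℕ, 1 ≤ k → ¬ LC (T ^ k : Equiv.Perm ℝ) x) (j : ℤ) :
    S ((T ^ j) x) ∈ L := by
  obtain ⟨K, -, hK⟩ := exists_notMem hinj hF (s := -1) (by norm_num)
  obtain ⟨l, hl, hl'⟩ := exists_notMem hinj hF (s := 1) (by norm_num)
  have e1 : (T ^ (-1 * (K:ℤ))) = (T ^ K)⁻¹ := by simp
  have e2 : (T ^ (1 * (l:ℤ))) = T ^ l := by simp
  rw [e1] at hK
  rw [e2] at hl'
  have key : S ((T ^ K)⁻¹ x) ∈ L := by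
    by_contra hp
    have h1 : LC (S * (T ^ K)⁻¹ : Equiv.Perm ℝ) x := (hback K).comp (hSF _ hK)
    have h2 : LC (T ^ (l + K) * (S * (T ^ K)⁻¹) : Equiv.Perm ℝ) x :=
      h1.comp (LC_pow_of_notMem hTL hLC (l + K) hp)
    have e : T ^ (l + K) * (S * (T ^ K)⁻¹) = S * T ^ l := by
      rw [← mul_assoc, ← (hcomm.pow_right (l + K)).eq, pow_add]; group
    rw [e] at h2
    apply hforw l hl
    obtain ⟨d, hd, h2⟩ := h2
    obtain ⟨d', hd', h3⟩ := hSF _ hl'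
    refine ⟨min d d', lt_min hd hd', fun ε h0 h => ?_⟩
    apply S.injective
    rw [h3 ε h0 (h.trans_le (min_le_right _ _))]
    exact h2 ε h0 (h.trans_le (min_le_left _ _))
  have : S ((T ^ j) x) = (T ^ (j + K)) (S ((T ^ K)⁻¹ x)) := by
    have e : S * T ^ j = T ^ (j + K) * (S * (T ^ K)⁻¹) := by
      rw [← mul_assoc, ← (hcomm.zpow_right (j + K)).eq, zpow_add]; simp [mul_assoc]
    exact congrArg (fun f : Equiv.Perm ℝ => f x) e
  rw [this, mem_pow_iff hTL]
  exact key

theorem S_LC {L : AddSubgroup ℝ} {T S : Equiv.Perm ℝ} (hcomm : Commute S T)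
    (hTL : ∀ x, T x - x ∈ L) (hLC : ∀ x, x ∉ L → LC T x)
    {F : Set ℝ} (hF : F.Finite) (hSF : ∀ x, x ∉ F → LC S x) (hSL : ∀ x, S x - x ∈ L) {x : ℝ}
    (hinj : Function.Injective (fun k : ℤ => (T ^ k) x)) (hx : x ∉ L) : LC S x := by
  obtain ⟨l, hl, hl'⟩ := exists_notMem hinj hF (s := 1) (by norm_num)
  have e2 : (T ^ (1 * (l:ℤ))) = T ^ l := by simp
  rw [e2] at hl'
  have h1 : LC (S * T ^ l : Equiv.Perm ℝ) x := (LC_pow_of_notMem hTL hLC l hx).comp (hSF _ hl')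
  have hSx : S x ∉ L := by
    intro h
    have := L.sub_mem h (hSL x)
    simp at this
    exact hx this
  have h3 := (LC_pow_of_notMem hTL hLC l hSx).inv
  have e : (T ^ l) (S x) = (S * T ^ l) x := by
    rw [(hcomm.pow_right l).eq]; rfl
  rw [e] at h3
  have h4 := h1.comp h3
  have e' : (T ^ l)⁻¹ * (S * T ^ l) = S := by
    rw [(hcomm.pow_right l).eq]; group
  have e'' : ⇑(T ^ l)⁻¹ ∘ ⇑(S * T ^ l) = ⇑S := congrArg (fun f : Equiv.Perm ℝ => (f : ℝ → ℝ)) e'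
  rwa [e''] at h4

open MeasureTheory in
theorem mp_of_pieces {ι : Type*} [Fintype ι] (P : ι → Set ℝ) (c : ι → ℝ) (S : Equiv.Perm ℝ)
    (hP : ∀ i, MeasurableSet (P i)) (hdisj : Pairwise (Function.onFun Disjoint P))
    (hcov : ∀ x, ∃ i, x ∈ P i) (hS : ∀ i, ∀ x ∈ P i, S x = x + c i) :
    MeasurePreserving S volume volume := by
  have pre : ∀ A : Set ℝ, S ⁻¹' A = ⋃ i, (P i ∩ (fun x => x + c i) ⁻¹' A) := by
    intro A
    ext x
    simp only [mem_preimage, mem_iUnion, mem_inter_iff]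
    constructor
    · intro h
      obtain ⟨i, hi⟩ := hcov x
      exact ⟨i, hi, by rw [← hS i x hi]; exact h⟩
    · rintro ⟨i, hi, h⟩
      rw [hS i x hi]; exact h
  have hm : ∀ A : Set ℝ, MeasurableSet A → ∀ i, MeasurableSet (P i ∩ (fun x => x + c i) ⁻¹' A) :=
    fun A hA i => (hP i).inter ((measurable_add_const (c i)) hA)
  refine ⟨fun A hA => ?_, ?_⟩
  · rw [pre]
    exact MeasurableSet.iUnion (hm A hA)
  · ext A hA
    have hmeas : Measurable S := fun A hA => by
      rw [pre]
      exact MeasurableSet.iUnion (hm A hA)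
    rw [Measure.map_apply hmeas hA, pre, measure_iUnion _ (hm A hA)]
    · have hA' : A = ⋃ i, ((fun x => x + (- c i)) ⁻¹' (P i) ∩ A) := by
        ext y
        simp only [mem_preimage, mem_iUnion, mem_inter_iff]
        constructor
        · intro h
          obtain ⟨i, hi⟩ := hcov (S.symm y)
          have := hS i _ hi
          simp only [Equiv.apply_symm_apply] at this
          refine ⟨i, ?_, h⟩
          rw [this]; simpa using hi
        · rintro ⟨i, _, h⟩
          exact h
      conv_rhs => rw [hA']
      rw [measure_iUnion]
      · congr 1
        ext i
        rw [← measure_preimage_add_right volume (c i) ((fun x => x + (- c i)) ⁻¹' (P i) ∩ A)]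
        congr 1
        ext x
        simp
      · intro i j hij
        rw [Function.onFun, Set.disjoint_left]
        rintro y ⟨h1, -⟩ ⟨h2, -⟩
        simp only [mem_preimage] at h1 h2
        have e1 := hS i _ h1
        have e2 := hS j _ h2
        have : y + -c i = y + - c j := S.injective (by rw [e1, e2]; ring)
        rw [← this] at h2
        exact Set.disjoint_left.1 (hdisj hij) h1 h2
      · intro i
        exact ((measurable_add_const (- c i)) (hP i)).inter hA
    · intro i j hij
      exact (hdisj hij).mono inter_subset_left inter_subset_left

open MeasureTheory in
theorem integral_step {ι : Type*} [Fintype ι] (l r : ι → ℝ) (hlr : ∀ i, l i ≤ r i)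
    (hdisj : Pairwise (Function.onFun Disjoint fun i => Ico (l i) (r i)))
    (hcov : Ico (0:ℝ) 1 = ⋃ i, Ico (l i) (r i)) (F : ℝ → ℝ) (v : ι → ℝ)
    (hF : ∀ i, ∀ x ∈ Ico (l i) (r i), F x = v i) :
    IntegrableOn F (Ico 0 1) ∧ ∫ x in Ico (0:ℝ) 1, F x = ∑ i, v i * (r i - l i) := by
  have hi : ∀ i, IntegrableOn F (Ico (l i) (r i)) := fun i => by
    have : IntegrableOn (fun _ : ℝ => v i) (Ico (l i) (r i)) := by
      exact integrableOn_const (by simp) (by simp)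
    exact this.congr_fun (fun x hx => (hF i x hx).symm) measurableSet_Ico
  constructor
  · rw [hcov]
    exact integrableOn_finite_iUnion.2 hi
  · rw [hcov, integral_iUnion_fintype (fun i => measurableSet_Ico) hdisj hi]
    congr 1
    ext i
    rw [setIntegral_congr_fun measurableSet_Ico (hF i), setIntegral_const]
    simp [Measure.real, hlr i, mul_comm]

open MeasureTheory in
theorem integral_pow_sum (S : Equiv.Perm ℝ) (hS : MeasurePreserving S volume volume)
    (hI : ∀ x, S x ∈ Ico (0:ℝ) 1 ↔ x ∈ Ico (0:ℝ) 1) (Φ : ℝ →ₗ[ℚ] ℚ) (n : ℕ)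
    (hint : IntegrableOn (fun x => (Φ (S x - x) : ℝ)) (Ico 0 1)) :
    ∫ x in Ico (0:ℝ) 1, (Φ ((S ^ n) x - x) : ℝ)
      = n * ∫ x in Ico (0:ℝ) 1, (Φ (S x - x) : ℝ) := by
  have hpre : S ⁻¹' (Ico (0:ℝ) 1) = Ico 0 1 := by ext x; exact hI x
  have hmp : MeasurePreserving S (volume.restrict (Ico (0:ℝ) 1)) (volume.restrict (Ico (0:ℝ) 1)) := by
    have := hS.restrict_preimage (measurableSet_Ico (a := (0:ℝ)) (b := 1))
    rwa [hpre] at this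
  have hmp' : ∀ k : ℕ, MeasurePreserving (S ^ k : Equiv.Perm ℝ)
      (volume.restrict (Ico (0:ℝ) 1)) (volume.restrict (Ico (0:ℝ) 1)) := fun k => by
    rw [← Equiv.Perm.iterate_eq_pow]
    exact hmp.iterate k
  have hemb : ∀ k : ℕ, MeasurableEmbedding (S ^ k : Equiv.Perm ℝ) := fun k =>
    (hmp' k).measurable.measurableEmbedding (S ^ k : Equiv.Perm ℝ).injective
  have tele : ∀ x, (Φ ((S ^ n) x - x) : ℝ)
      = ∑ k ∈ Finset.range n, (fun y => (Φ (S y - y) : ℝ)) ((S ^ k) x) := by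
    intro x
    have := Finset.sum_range_sub (fun k => (S ^ k) x) n
    simp only [pow_zero, Equiv.Perm.one_apply] at this
    rw [← this, map_sum]
    rw [Rat.cast_sum]
    refine Finset.sum_congr rfl fun k _ => ?_
    rw [pow_succ', Equiv.Perm.mul_apply]
  rw [integral_congr_ae (Filter.Eventually.of_forall tele), integral_finsetSum]
  · rw [Finset.sum_congr rfl (fun k _ => (hmp' k).integral_comp (hemb k)
      (fun y => (Φ (S y - y) : ℝ)))]
    simp
  · intro k _
    exact ((hmp' k).integrable_comp_emb (hemb k)).2 hint

theorem abel_mem (L : AddSubgroup ℝ) (β : ℕ → ℝ) (v : ℕ → ℤ) (h0 : β 0 = 0) (k : ℕ)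
    (hb : ∀ i, i + 1 < k → β (i + 1) ∈ L ∨ v (i + 1) = v i) (hk : β k ∈ L) :
    ∑ i ∈ Finset.range k, (v i : ℝ) * (β (i + 1) - β i) ∈ L := by
  have zm : ∀ (z : ℤ) x, x ∈ L → (z : ℝ) * x ∈ L := fun z x hx => by
    have := L.zsmul_mem hx z
    rwa [zsmul_eq_mul] at this
  rcases k with _ | k
  · simp
  have key : ∀ j, j < k + 1 →
      ∑ i ∈ Finset.range (j + 1), (v i : ℝ) * (β (i + 1) - β i) - v j * β (j + 1) ∈ L := by
    intro j
    induction j with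
    | zero => intro _; simp [h0]
    | succ j ih =>
      intro hj
      have h1 := ih (by omega)
      rw [Finset.sum_range_succ]
      have h2 : ((v j - v (j + 1) : ℤ) : ℝ) * β (j + 1) ∈ L := by
        rcases hb j hj with h | h
        · exact zm _ _ h
        · simp [h]
      have := L.add_mem h1 h2
      convert this using 1
      push_cast
      ring
  have := L.add_mem (key k (by omega)) (zm (v k) _ hk)
  simpa using this

/-- Data describing an IET with `ℕ`-indexed break points. -/
structure Data (S : ℝ → ℝ) (k : ℕ) (β c : ℕ → ℝ) : Prop where
  zero : β 0 = 0
  last : β k = 1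
  lt : ∀ i < k, β i < β (i + 1)
  tr : ∀ i < k, ∀ x ∈ Ico (β i) (β (i + 1)), S x = x + c i
  out : ∀ x, x ∉ Ico (0:ℝ) 1 → S x = x

theorem exists_data {S : ℝ → ℝ} (h : IsIET S) : ∃ k β c, Data S k β c := by
  obtain ⟨-, hout, k, β, hβ, h0, h1, hc⟩ := h
  choose c hc using hc
  refine ⟨k, fun i => if h : i < k + 1 then β ⟨i, h⟩ else 0, fun i => if h : i < k then c ⟨i, h⟩ else 0,
    ?_, ?_, ?_, ?_, hout⟩
  · simpa using h0
  · simpa [Fin.last] using h1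
  · intro i hi
    simp only [show i < k + 1 by omega, show i + 1 < k + 1 by omega, dif_pos]
    exact hβ (by simp)
  · intro i hi x hx
    simp only [show i < k + 1 by omega, show i + 1 < k + 1 by omega, hi, dif_pos] at hx ⊢
    exact hc ⟨i, hi⟩ x hx

theorem Data.mono {S : ℝ → ℝ} {k : ℕ} {β c : ℕ → ℝ} (h : Data S k β c) {i j : ℕ} (hij : i ≤ j) (hj : j ≤ k) :
    β i ≤ β j := by
  induction j, hij using Nat.le_induction with
  | base => exact le_rfl
  | succ j hij ih => exact (ih (by omega)).trans (h.lt j (by omega)).le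

theorem Data.cover {S : ℝ → ℝ} {k : ℕ} {β c : ℕ → ℝ} (h : Data S k β c) {x : ℝ} (hx : x ∈ Ico (0:ℝ) 1) :
    ∃ i < k, x ∈ Ico (β i) (β (i + 1)) := by
  have : ∀ j ≤ k, x < β j → ∃ i < k, x ∈ Ico (β i) (β (i + 1)) := by
    intro j
    induction j with
    | zero => intro _ h'; rw [h.zero] at h'; exact absurd hx.1 (not_le.2 h')
    | succ j ih =>
      intro hj hxj
      by_cases h' : x < β j
      · exact ih (by omega) h'
      · exact ⟨j, by omega, not_lt.1 h', hxj⟩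
  exact this k le_rfl (by rw [h.last]; exact hx.2)

theorem Data.disj {S : ℝ → ℝ} {k : ℕ} {β c : ℕ → ℝ} (h : Data S k β c) {i j : ℕ} (hi : i < k) (hj : j < k)
    (hij : i ≠ j) : Disjoint (Ico (β i) (β (i + 1))) (Ico (β j) (β (j + 1))) := by
  rw [Set.disjoint_left]
  rintro x ⟨h1, h2⟩ ⟨h3, h4⟩
  rcases lt_or_gt_of_ne hij with hlt | hlt
  · have := h.mono (i := i + 1) (j := j) (by omega) (by omega)
    linarith
  · have := h.mono (i := j + 1) (j := i) (by omega) (by omega)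
    linarith

theorem Data.sub {S : ℝ → ℝ} {k : ℕ} {β c : ℕ → ℝ} (h : Data S k β c) {i : ℕ} (hi : i < k) :
    Ico (β i) (β (i + 1)) ⊆ Ico (0:ℝ) 1 := by
  have h1 := h.mono (i := 0) (j := i) (by omega) (by omega)
  have h2 := h.mono (i := i + 1) (j := k) (by omega) le_rfl
  rw [h.zero] at h1
  rw [h.last] at h2
  exact Ico_subset_Ico h1 h2

theorem LC_out {S : ℝ → ℝ} (hout : ∀ x, x ∉ Ico (0:ℝ) 1 → S x = x) {x : ℝ} (hx : x ∉ Icc (0:ℝ) 1) : LC S x := by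
  by_cases h : x < 0
  · refine ⟨1, one_pos, fun ε h0 h1 => ?_⟩
    rw [hout, hout]
    · exact fun h' => by linarith [h'.1]
    · exact fun h' => by linarith [h'.1]
  · have h1 : 1 < x := by
      by_contra h1
      exact hx ⟨not_lt.1 h, not_lt.1 h1⟩
    refine ⟨x - 1, by linarith, fun ε h0 h1 => ?_⟩
    rw [hout, hout]
    · exact fun h' => by linarith [h'.2]
    · exact fun h' => by linarith [h'.2]

theorem LC_Ioo {S : ℝ → ℝ} {a b c x : ℝ} (h : ∀ x ∈ Ico a b, S x = x + c) (hx : x ∈ Ioo a b) : LC S x := by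
  refine ⟨x - a, by linarith [hx.1], fun ε h0 h1 => ?_⟩
  rw [h _ ⟨by linarith, by linarith [hx.2]⟩, h x ⟨hx.1.le, hx.2⟩]
  ring

theorem Data.LC {S : ℝ → ℝ} {k : ℕ} {β c : ℕ → ℝ} (h : Data S k β c) {x : ℝ}
    (hx : x ∉ β '' (Set.Iic k)) : LC S x := by
  by_cases hI : x ∈ Ico (0:ℝ) 1
  · obtain ⟨i, hi, hxi⟩ := h.cover hI
    refine LC_Ioo (h.tr i hi) ⟨lt_of_le_of_ne hxi.1 ?_, hxi.2⟩
    rintro rfl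
    exact hx ⟨i, by simp; omega, rfl⟩
  · apply LC_out h.out
    intro h'
    have : x = 1 := by
      by_contra hne
      exact hI ⟨h'.1, lt_of_le_of_ne h'.2 hne⟩
    exact hx ⟨k, by simp, by rw [h.last, this]⟩

theorem Data.const_eq {S : ℝ → ℝ} {k : ℕ} {β c : ℕ → ℝ} (h : Data S k β c) {i : ℕ} (hi : i + 1 < k)
    (hLC : IETRoots.LC S (β (i + 1))) : c (i + 1) = c i := by
  obtain ⟨d, hd, h'⟩ := hLC
  have h1 := h.lt i (by omega)
  have h2 := h.lt (i + 1) hi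
  set ε := min d (β (i + 1) - β i) / 2 with hε
  have h3 : 0 < min d (β (i + 1) - β i) := lt_min hd (by linarith)
  have h4 := min_le_left d (β (i + 1) - β i)
  have h5 := min_le_right d (β (i + 1) - β i)
  have := h' ε (by linarith) (by linarith)
  rw [h.tr (i + 1) hi _ ⟨le_rfl, h2⟩, h.tr i (by omega) _ ⟨by linarith, by linarith⟩] at this
  linarith

open MeasureTheory in
theorem Data.mp {S : Equiv.Perm ℝ} {k : ℕ} {β c : ℕ → ℝ} (h : Data S k β c) :
    MeasurePreserving S volume volume := by
  apply mp_of_pieces (ι := Option (Fin k))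
    (fun o => o.elim (Ico (0:ℝ) 1)ᶜ (fun i => Ico (β i) (β (i + 1))))
    (fun o => o.elim 0 (fun i => c i))
  · rintro (_ | i)
    · exact measurableSet_Ico.compl
    · exact measurableSet_Ico
  · rintro (_ | i) (_ | j) hij
    · exact absurd rfl hij
    · exact disjoint_compl_left.mono_right (h.sub j.2)
    · exact disjoint_compl_right.mono_left (h.sub i.2)
    · exact h.disj i.2 j.2 (fun e => hij (by rw [Fin.ext e]))
  · intro x
    by_cases hx : x ∈ Ico (0:ℝ) 1
    · obtain ⟨i, hi, hxi⟩ := h.cover hx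
      exact ⟨some ⟨i, hi⟩, hxi⟩
    · exact ⟨none, hx⟩
  · rintro (_ | i) x hx
    · simpa using h.out x hx
    · exact h.tr i i.2 x hx

open MeasureTheory in
theorem Data.integral {S : ℝ → ℝ} {k : ℕ} {β c : ℕ → ℝ} (h : Data S k β c) (Φ : ℝ →ₗ[ℚ] ℚ) :
    IntegrableOn (fun x => (Φ (S x - x) : ℝ)) (Ico 0 1) ∧
    ∫ x in Ico (0:ℝ) 1, (Φ (S x - x) : ℝ)
      = ∑ i ∈ Finset.range k, (Φ (c i) : ℝ) * (β (i + 1) - β i) := by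
  rw [← Fin.sum_univ_eq_sum_range (fun i => (Φ (c i) : ℝ) * (β (i + 1) - β i))]
  apply integral_step (fun i : Fin k => β i) (fun i => β (i + 1)) (fun i => (h.lt i i.2).le)
  · intro i j hij
    exact h.disj i.2 j.2 (fun e => hij (Fin.ext e))
  · ext x
    simp only [mem_iUnion]
    constructor
    · intro hx
      obtain ⟨i, hi, hxi⟩ := h.cover hx
      exact ⟨⟨i, hi⟩, hxi⟩
    · rintro ⟨i, hi⟩
      exact h.sub i.2 hi
  · intro i x hx
    simp only [h.tr i i.2 x hx, add_sub_cancel_left]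

/-- Total length of the intervals placed before the interval `a` in the order given by `σ`. -/
noncomputable def GG {m : ℕ} (σ : Equiv.Perm (Fin m)) (lam : Fin m → ℝ) (a : Fin m) : ℝ :=
  ∑ i ∈ Finset.univ.filter (fun i : Fin m => σ i < σ a), lam i

theorem betaPt_eq {m : ℕ} (lam : Fin m → ℝ) (a : Fin m) : betaPt lam (a : ℕ) = GG 1 lam a := by
  unfold betaPt GG
  congr 1

section GG
variable {m : ℕ} (σ : Equiv.Perm (Fin m)) (lam : Fin m → ℝ)

theorem GG_add (a : Fin m) :
    GG σ lam a + lam a = ∑ i ∈ Finset.univ.filter (fun i : Fin m => σ i ≤ σ a), lam i := by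
  have : Finset.univ.filter (fun i : Fin m => σ i ≤ σ a)
      = insert a (Finset.univ.filter (fun i : Fin m => σ i < σ a)) := by
    ext i
    simp only [Finset.mem_filter, Finset.mem_univ, true_and, Finset.mem_insert, le_iff_lt_or_eq,
      σ.injective.eq_iff]
    tauto
  rw [this, Finset.sum_insert (by simp), add_comm]
  rfl

theorem GG_le (hpos : ∀ i, 0 < lam i) {a a' : Fin m} (h : σ a < σ a') :
    GG σ lam a + lam a ≤ GG σ lam a' := by
  rw [GG_add]
  apply Finset.sum_le_sum_of_subset_of_nonneg
  · intro i
    simp only [Finset.mem_filter, Finset.mem_univ, true_and]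
    intro h'
    exact h'.trans_lt h
  · intro i _ _
    exact (hpos i).le

theorem GG_nonneg (hpos : ∀ i, 0 < lam i) (a : Fin m) : 0 ≤ GG σ lam a :=
  Finset.sum_nonneg fun i _ => (hpos i).le

theorem GG_le_one (hpos : ∀ i, 0 < lam i) (hsum : ∑ i, lam i = 1) (a : Fin m) :
    GG σ lam a + lam a ≤ 1 := by
  rw [GG_add, ← hsum]
  apply Finset.sum_le_sum_of_subset_of_nonneg (Finset.filter_subset _ _)
  intro i _ _
  exact (hpos i).le

theorem GG_succ {a a' : Fin m} (h : (σ a' : ℕ) = σ a + 1) : GG σ lam a' = GG σ lam a + lam a := by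
  rw [GG_add]
  unfold GG
  congr 1
  ext i
  simp only [Finset.mem_filter, Finset.mem_univ, true_and, Fin.lt_def, Fin.le_def]
  omega

theorem GG_last (hsum : ∑ i, lam i = 1) {a : Fin m} (h : (σ a : ℕ) + 1 = m) :
    GG σ lam a + lam a = 1 := by
  rw [GG_add, ← hsum]
  congr 1
  ext i
  simp only [Finset.mem_filter, Finset.mem_univ, true_and, Fin.le_def, iff_true]
  have := (σ i).2
  omega

theorem GG_zero {a : Fin m} (h : (σ a : ℕ) = 0) : GG σ lam a = 0 := by
  unfold GG
  apply Finset.sum_eq_zero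
  intro i
  simp only [Finset.mem_filter, Finset.mem_univ, true_and, Fin.lt_def]
  omega

theorem GG_cover (hpos : ∀ i, 0 < lam i) (hsum : ∑ i, lam i = 1) {x : ℝ} (hx : x ∈ Ico (0:ℝ) 1) :
    ∃ a, x ∈ Ico (GG σ lam a) (GG σ lam a + lam a) := by
  have hm : 0 < m := by
    rcases m with _ | m
    · simp at hsum
    · omega
  have : ∀ j : ℕ, ∀ hj : j < m, GG σ lam (σ.symm ⟨j, hj⟩) ≤ x →
      ∃ a, x ∈ Ico (GG σ lam a) (GG σ lam a + lam a) := by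
    intro j hj
    induction hd : m - 1 - j generalizing j with
    | zero =>
      intro h
      refine ⟨_, h, ?_⟩
      rw [GG_last σ lam hsum]
      · exact hx.2
      · simp; omega
    | succ d ih =>
      intro h
      by_cases h' : x < GG σ lam (σ.symm ⟨j, hj⟩) + lam (σ.symm ⟨j, hj⟩)
      · exact ⟨_, h, h'⟩
      · apply ih (j + 1) (by omega) (by omega)
        rw [GG_succ σ lam (a := σ.symm ⟨j, hj⟩)]
        · exact not_lt.1 h'
        · simp
  apply this 0 hm
  rw [GG_zero σ lam (by simp)]
  exact hx.1

theorem GG_uniq (hpos : ∀ i, 0 < lam i) {x : ℝ} {a b : Fin m}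
    (ha : x ∈ Ico (GG σ lam a) (GG σ lam a + lam a)) (hb : x ∈ Ico (GG σ lam b) (GG σ lam b + lam b)) :
    a = b := by
  rcases lt_trichotomy (σ a) (σ b) with h | h | h
  · have := GG_le σ lam hpos h
    linarith [ha.2, hb.1]
  · exact σ.injective h
  · have := GG_le σ lam hpos h
    linarith [hb.2, ha.1]

theorem GG_sub (hpos : ∀ i, 0 < lam i) (hsum : ∑ i, lam i = 1) (a : Fin m) :
    Ico (GG σ lam a) (GG σ lam a + lam a) ⊆ Ico (0:ℝ) 1 :=
  Ico_subset_Ico (GG_nonneg σ lam hpos a) (GG_le_one σ lam hpos hsum a)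

theorem iet_apply (hpos : ∀ i, 0 < lam i) {x : ℝ} {a : Fin m}
    (ha : x ∈ Ico (GG 1 lam a) (GG 1 lam a + lam a)) :
    ietMap σ lam x = x + (GG σ lam a - GG 1 lam a) := by
  unfold ietMap
  have h : ∃ j : Fin m, x ∈ Set.Ico (betaPt lam (j : ℕ)) (betaPt lam (j : ℕ) + lam j) :=
    ⟨a, by rw [betaPt_eq]; exact ha⟩
  rw [dif_pos h]
  have hc := h.choose_spec
  rw [betaPt_eq] at hc
  have := GG_uniq 1 lam hpos ha hc
  rw [← this, betaPt_eq]
  unfold GG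
  ring

theorem iet_out (hpos : ∀ i, 0 < lam i) (hsum : ∑ i, lam i = 1) {x : ℝ} (hx : x ∉ Ico (0:ℝ) 1) :
    ietMap σ lam x = x := by
  unfold ietMap
  rw [dif_neg]
  rintro ⟨j, hj⟩
  rw [betaPt_eq] at hj
  exact hx (GG_sub 1 lam hpos hsum j hj)

theorem iet_left (hpos : ∀ i, 0 < lam i) (a : Fin m) :
    ietMap σ lam (GG 1 lam a) = GG σ lam a := by
  rw [iet_apply σ lam hpos (a := a) ⟨le_rfl, by linarith [hpos a]⟩]
  ring

theorem GG_mem (a : Fin m) : GG σ lam a ∈ AddSubgroup.closure (range lam) := by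
  apply AddSubgroup.sum_mem
  intro i _
  exact AddSubgroup.subset_closure ⟨i, rfl⟩

theorem iet_sub_mem (hpos : ∀ i, 0 < lam i) (hsum : ∑ i, lam i = 1) (x : ℝ) :
    ietMap σ lam x - x ∈ AddSubgroup.closure (range lam) := by
  by_cases hx : x ∈ Ico (0:ℝ) 1
  · obtain ⟨a, ha⟩ := GG_cover 1 lam hpos hsum hx
    rw [iet_apply σ lam hpos ha, add_sub_cancel_left]
    exact AddSubgroup.sub_mem _ (GG_mem _ _ _) (GG_mem _ _ _)
  · rw [iet_out σ lam hpos hsum hx]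
    simp

theorem iet_LC_of_ne (hpos : ∀ i, 0 < lam i) (hsum : ∑ i, lam i = 1) {x : ℝ} (hx : x ∈ Ico (0:ℝ) 1)
    (hne : ∀ a, x ≠ GG 1 lam a) : LC (ietMap σ lam) x := by
  obtain ⟨a, ha⟩ := GG_cover 1 lam hpos hsum hx
  exact LC_Ioo (fun y hy => iet_apply σ lam hpos hy) ⟨lt_of_le_of_ne ha.1 (hne a).symm, ha.2⟩

theorem one_mem (hsum : ∑ i, lam i = 1) : (1:ℝ) ∈ AddSubgroup.closure (range lam) := by
  rw [← hsum]
  apply AddSubgroup.sum_mem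
  intro i _
  exact AddSubgroup.subset_closure ⟨i, rfl⟩

theorem iet_LC (hpos : ∀ i, 0 < lam i) (hsum : ∑ i, lam i = 1) {x : ℝ}
    (hx : x ∉ AddSubgroup.closure (range lam)) : LC (ietMap σ lam) x := by
  by_cases hI : x ∈ Ico (0:ℝ) 1
  · apply iet_LC_of_ne σ lam hpos hsum hI
    rintro a rfl
    exact hx (GG_mem _ _ _)
  · apply LC_out (fun x hx => iet_out σ lam hpos hsum hx)
    intro h'
    have : x = 1 := by
      by_contra hne
      exact hI ⟨h'.1, lt_of_le_of_ne h'.2 hne⟩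
    rw [this] at hx
    exact hx (one_mem lam hsum)

/-- Coordinate functionals dual to the (rationally independent) lengths. -/
theorem exists_dual (hindep : LinearIndependent ℚ lam) :
    ∃ Φ : Fin m → (ℝ →ₗ[ℚ] ℚ), ∀ i j, Φ i (lam j) = if i = j then 1 else 0 := by
  have : ∀ i, ∃ φ : ℝ →ₗ[ℚ] ℚ, ∀ j, φ (lam j) = if i = j then 1 else 0 := by
    intro i
    let b := Module.Basis.span hindep
    obtain ⟨φ, hφ⟩ := LinearMap.exists_extend (b.coord i)
    refine ⟨φ, fun j => ?_⟩
    have h1 : φ (lam j) = (φ ∘ₗ (Submodule.span ℚ (range lam)).subtype) (b j) := by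
      simp [b, Module.Basis.span_apply]
    rw [h1, hφ]
    simp [Finsupp.single_apply, eq_comm]
  choose Φ hΦ using this
  exact ⟨Φ, hΦ⟩

theorem dual_int {Φ : Fin m → (ℝ →ₗ[ℚ] ℚ)} (hΦ : ∀ i j, Φ i (lam j) = if i = j then 1 else 0)
    (i : Fin m) {x : ℝ} (hx : x ∈ AddSubgroup.closure (range lam)) : ∃ z : ℤ, Φ i x = z := by
  induction hx using AddSubgroup.closure_induction with
  | mem x hx =>
    obtain ⟨j, rfl⟩ := hx
    rw [hΦ]
    split_ifs
    · exact ⟨1, by simp⟩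
    · exact ⟨0, by simp⟩
  | zero => exact ⟨0, by simp⟩
  | add x y _ _ hx hy =>
    obtain ⟨a, ha⟩ := hx
    obtain ⟨b, hb⟩ := hy
    exact ⟨a + b, by rw [map_add, ha, hb]; push_cast; rfl⟩
  | neg x _ hx =>
    obtain ⟨a, ha⟩ := hx
    exact ⟨-a, by rw [map_neg, ha]; push_cast; rfl⟩

theorem dual_GG {Φ : Fin m → (ℝ →ₗ[ℚ] ℚ)} (hΦ : ∀ i j, Φ i (lam j) = if i = j then 1 else 0)
    (i a : Fin m) : Φ i (GG σ lam a) = if σ i < σ a then 1 else 0 := by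
  unfold GG
  rw [map_sum]
  simp only [hΦ]
  rw [Finset.sum_ite_eq]
  simp

open MeasureTheory in
theorem iet_integral (hpos : ∀ i, 0 < lam i) (hsum : ∑ i, lam i = 1) (φ : ℝ →ₗ[ℚ] ℚ) :
    ∫ x in Ico (0:ℝ) 1, (φ (ietMap σ lam x - x) : ℝ)
      = ∑ a, (φ (GG σ lam a - GG 1 lam a) : ℝ) * lam a := by
  have := (integral_step (fun a : Fin m => GG 1 lam a) (fun a => GG 1 lam a + lam a)
    (fun a => by linarith [hpos a])
    (fun a b hab => Set.disjoint_left.2 fun x hxa hxb => hab (GG_uniq 1 lam hpos hxa hxb))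
    (by
      ext x
      simp only [mem_iUnion]
      exact ⟨fun hx => GG_cover 1 lam hpos hsum hx, fun ⟨a, ha⟩ => GG_sub 1 lam hpos hsum a ha⟩)
    (fun x => (φ (ietMap σ lam x - x) : ℝ)) (fun a => (φ (GG σ lam a - GG 1 lam a) : ℝ))
    (fun a x hx => by
      simp only [iet_apply σ lam hpos hx, add_sub_cancel_left])).2
  rw [this]
  simp

end GG

theorem mem_orbit {T : Equiv.Perm ℝ} {x y : ℝ} (h : y ∈ orbitZ T x) : ∃ k : ℤ, y = (T ^ k) x := by
  obtain ⟨n, h | h⟩ := h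
  · refine ⟨n, ?_⟩
    rw [← h, Equiv.Perm.iterate_eq_pow, zpow_natCast]
  · refine ⟨-n, ?_⟩
    rw [← h, Equiv.Perm.iterate_eq_pow, zpow_neg, zpow_natCast]
    simp

theorem zpow_iff {T : Equiv.Perm ℝ} {P : ℝ → Prop} (h : ∀ x, P (T x) ↔ P x) (k : ℤ) (x : ℝ) :
    P ((T ^ k) x) ↔ P x := by
  induction k using Int.induction_on with
  | zero => simp
  | succ k ih =>
    rw [add_comm, zpow_add, zpow_one, Equiv.Perm.mul_apply, h]
    exact ih
  | pred k ih =>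
    refine Iff.trans ?_ ih
    rw [← h]
    have : T ((T ^ (-(k:ℤ) - 1)) x) = (T ^ (-(k:ℤ))) x := by
      rw [← Equiv.Perm.mul_apply, ← zpow_one_add]; congr 2; ring
    rw [this]

theorem aperiodic {T : Equiv.Perm ℝ} (hmin : IsMinimal T) {x : ℝ} (hx : x ∈ Ico (0:ℝ) 1) :
    Function.Injective (fun k : ℤ => (T ^ k) x) := by
  have key : ∀ p : ℕ, 1 ≤ p → (T ^ p) x ≠ x := by
    intro p hp hpx
    have hpz : ∀ q : ℤ, (T ^ ((p : ℤ) * q)) x = x := by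
      intro q
      rw [zpow_mul, zpow_natCast]
      exact Equiv.Perm.zpow_apply_eq_self_of_apply_eq_self hpx q
    have hfin : (orbitZ T x).Finite := by
      apply ((Finset.range p).finite_toSet.image (fun k : ℕ => (T ^ k) x)).subset
      intro y hy
      obtain ⟨k, rfl⟩ := mem_orbit hy
      have h0 : 0 ≤ k % p := Int.emod_nonneg _ (by omega)
      have h1 : k % p < p := Int.emod_lt_of_pos _ (by omega)
      refine ⟨(k % p).toNat, by simp; omega, ?_⟩
      have : (T ^ k) x = (T ^ (k % p)) x := by
        conv_lhs => rw [← Int.emod_add_mul_ediv k p, zpow_add, Equiv.Perm.mul_apply, hpz]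
      simp only
      rw [this, ← zpow_natCast, Int.toNat_of_nonneg h0]
    have hsub := hmin x hx
    rw [hfin.isClosed.closure_eq] at hsub
    exact (Ico_infinite (show (0:ℝ) < 1 by norm_num)) (hfin.subset hsub)
  have key2 : ∀ a b : ℤ, a < b → (T ^ a) x ≠ (T ^ b) x := by
    intro a b hab h
    apply key (b - a).toNat (by omega)
    rw [← zpow_natCast, Int.toNat_of_nonneg (by omega), sub_eq_neg_add, zpow_add, Equiv.Perm.mul_apply,
      ← h, zpow_neg]
    simp
  intro a b h
  rcases lt_trichotomy a b with h' | h' | h'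
  · exact absurd h (key2 a b h')
  · exact h'
  · exact absurd h.symm (key2 b a h')

theorem no_inv {T : Equiv.Perm ℝ} (hmin : IsMinimal T) (hI : ∀ x, T x ∈ Ico (0:ℝ) 1 ↔ x ∈ Ico (0:ℝ) 1)
    {s : ℝ} (h0 : 0 < s) (h1 : s < 1) (h : ∀ x ∈ Ico (0:ℝ) 1, T x < s ↔ x < s) : False := by
  have hz : (0:ℝ) ∈ unitI := ⟨le_rfl, one_pos⟩
  have hsub : orbitZ T 0 ⊆ Iic s := by
    intro y hy
    obtain ⟨k, rfl⟩ := mem_orbit hy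
    have := (zpow_iff (T := T) (P := fun x => x ∈ Ico (0:ℝ) 1 ∧ x < s) (fun x => by
      constructor
      · rintro ⟨ha, hb⟩
        exact ⟨(hI x).1 ha, (h x ((hI x).1 ha)).1 hb⟩
      · rintro ⟨ha, hb⟩
        exact ⟨(hI x).2 ha, (h x ha).2 hb⟩) k 0).2 ⟨hz, h0⟩
    exact this.2.le
  have h2 := hmin 0 hz (show (s + 1) / 2 ∈ unitI from ⟨by linarith, by linarith⟩)
  have h3 := closure_minimal hsub isClosed_Iic h2
  have : (s + 1) / 2 ≤ s := h3
  linarith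

section dyn
variable {m : ℕ} (σ : Equiv.Perm (Fin m)) (lam : Fin m → ℝ)

theorem iet_image (hpos : ∀ i, 0 < lam i) {x : ℝ} {a : Fin m}
    (ha : x ∈ Ico (GG 1 lam a) (GG 1 lam a + lam a)) :
    ietMap σ lam x ∈ Ico (GG σ lam a) (GG σ lam a + lam a) := by
  rw [iet_apply σ lam hpos ha]
  exact ⟨by linarith [ha.1], by linarith [ha.2]⟩

theorem iet_Ico (hpos : ∀ i, 0 < lam i) (hsum : ∑ i, lam i = 1) (x : ℝ) :
    ietMap σ lam x ∈ Ico (0:ℝ) 1 ↔ x ∈ Ico (0:ℝ) 1 := by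
  constructor
  · intro h
    by_contra hx
    rw [iet_out σ lam hpos hsum hx] at h
    exact hx h
  · intro h
    obtain ⟨a, ha⟩ := GG_cover 1 lam hpos hsum h
    exact GG_sub σ lam hpos hsum a (iet_image σ lam hpos ha)

theorem GG_iff (hpos : ∀ i, 0 < lam i) {y : ℝ} {a l : Fin m}
    (hy : y ∈ Ico (GG σ lam l) (GG σ lam l + lam l)) :
    GG σ lam a + lam a ≤ y ↔ σ a < σ l := by
  constructor
  · intro h
    by_contra h'
    rcases eq_or_lt_of_le (not_lt.1 h') with e | e
    · have := σ.injective e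
      subst this
      linarith [hy.2]
    · have := GG_le σ lam hpos e
      linarith [hy.2, hpos a]
  · intro h
    exact (GG_le σ lam hpos h).trans hy.1

theorem GG_downset (hpos : ∀ i, 0 < lam i) {y : ℝ} {l : Fin m}
    (hy : y ∈ Ico (GG σ lam l) (GG σ lam l + lam l)) (B : Finset (Fin m))
    (hB : ∀ a a', σ a ≤ σ a' → a' ∈ B → a ∈ B) : y < ∑ a ∈ B, lam a ↔ l ∈ B := by
  constructor
  · intro h
    by_contra hl
    have : ∑ a ∈ B, lam a ≤ GG σ lam l := by
      apply Finset.sum_le_sum_of_subset_of_nonneg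
      · intro a ha
        simp only [Finset.mem_filter, Finset.mem_univ, true_and]
        by_contra h'
        exact hl (hB l a (not_lt.1 h') ha)
      · intro i _ _
        exact (hpos i).le
    linarith [hy.1]
  · intro hl
    refine hy.2.trans_le ?_
    rw [GG_add]
    apply Finset.sum_le_sum_of_subset_of_nonneg
    · intro a ha
      simp only [Finset.mem_filter, Finset.mem_univ, true_and] at ha
      exact hB a l ha hl
    · intro i _ _
      exact (hpos i).le

theorem idoc {T : Equiv.Perm ℝ} (hT : ⇑T = ietMap σ lam) (hpos : ∀ i, 0 < lam i)
    (hsum : ∑ i, lam i = 1) (hmin : IsMinimal T)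
    {Φ : Fin m → (ℝ →ₗ[ℚ] ℚ)} (hΦ : ∀ i j, Φ i (lam j) = if i = j then 1 else 0)
    (i j : Fin m) (hj : 0 < (j : ℕ)) (k : ℕ) : (T ^ (k + 1)) (GG 1 lam i) ≠ GG 1 lam j := by
  classical
  intro heq
  have hI : ∀ x, T x ∈ Ico (0:ℝ) 1 ↔ x ∈ Ico (0:ℝ) 1 := fun x => by
    rw [hT]; exact iet_Ico σ lam hpos hsum x
  set x : ℕ → ℝ := fun l => (T ^ l) (GG 1 lam i) with hx
  have hmemG : ∀ a : Fin m, GG 1 lam a ∈ Ico (GG 1 lam a) (GG 1 lam a + lam a) :=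
    fun a => ⟨le_rfl, by linarith [hpos a]⟩
  have hxI : ∀ l, x l ∈ Ico (0:ℝ) 1 := by
    intro l
    have := (zpow_iff (P := fun x => x ∈ Ico (0:ℝ) 1) hI l (GG 1 lam i)).2
      (GG_sub 1 lam hpos hsum i (hmemG i))
    rw [zpow_natCast] at this
    exact this
  have hxs : ∀ l, x (l + 1) = T (x l) := by
    intro l
    simp only [hx, pow_succ', Equiv.Perm.mul_apply]
  let r : Fin m → ℝ → ℚ := fun a y => if GG 1 lam a + lam a ≤ y then 1 else 0
  let s : Fin m → ℝ → ℚ := fun a y => if GG σ lam a + lam a ≤ y then 1 else 0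
  have hstep : ∀ a y, y ∈ Ico (0:ℝ) 1 → Φ a (T y) - Φ a y = s a (T y) - r a y := by
    intro a y hy
    obtain ⟨l, hl⟩ := GG_cover 1 lam hpos hsum hy
    have hl' := iet_image σ lam hpos hl
    simp only [r, s]
    rw [hT, ← map_sub]
    simp only [GG_iff 1 lam hpos hl, GG_iff σ lam hpos hl']
    rw [iet_apply σ lam hpos hl, add_sub_cancel_left, map_sub, dual_GG σ lam hΦ, dual_GG 1 lam hΦ]
  have hr : ∀ a l, Φ a (GG 1 lam l) = r a (GG 1 lam l) := by
    intro a l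
    rw [dual_GG 1 lam hΦ]
    simp only [r, GG_iff 1 lam hpos (hmemG l)]
  have hsumeq : ∀ a, ∑ l ∈ Finset.range (k + 1), s a (x (l + 1))
      = ∑ l ∈ Finset.range (k + 1), r a (x (l + 1)) := by
    intro a
    have t1 := Finset.sum_range_sub (fun l => Φ a (x l)) (k + 1)
    have t2 := Finset.sum_range_sub (fun l => r a (x l)) (k + 1)
    have e0 : x 0 = GG 1 lam i := by simp [hx]
    have ek : x (k + 1) = GG 1 lam j := heq
    rw [e0, ek, hr, hr] at t1
    rw [e0, ek, ← t1] at t2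
    have t3 : ∑ l ∈ Finset.range (k + 1), (Φ a (x (l + 1)) - Φ a (x l))
        = ∑ l ∈ Finset.range (k + 1), (s a (x (l + 1)) - r a (x l)) :=
      Finset.sum_congr rfl (fun l _ => by rw [hxs l, hstep a (x l) (hxI l)])
    rw [t3, Finset.sum_sub_distrib, Finset.sum_sub_distrib] at t2
    linarith
  have hiff : ∀ a, (∃ l ∈ Finset.range (k + 1), GG σ lam a + lam a ≤ x (l + 1)) ↔
      (∃ l ∈ Finset.range (k + 1), GG 1 lam a + lam a ≤ x (l + 1)) := by
    intro a
    have hz1 := Finset.sum_eq_zero_iff_of_nonneg (s := Finset.range (k + 1))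
      (f := fun l => s a (x (l + 1))) (fun l _ => by simp only [s]; split_ifs <;> norm_num)
    have hz2 := Finset.sum_eq_zero_iff_of_nonneg (s := Finset.range (k + 1))
      (f := fun l => r a (x (l + 1))) (fun l _ => by simp only [r]; split_ifs <;> norm_num)
    rw [hsumeq a, hz2] at hz1
    simp only [r, s, ite_eq_right_iff, one_ne_zero, imp_false] at hz1
    have := not_congr hz1
    push Not at this
    exact this.symm
  let B : Finset (Fin m) := Finset.univ.filter
    (fun a => ∃ l ∈ Finset.range (k + 1), GG 1 lam a + lam a ≤ x (l + 1))
  have hB1 : ∀ a, a ∈ B ↔ ∃ l ∈ Finset.range (k + 1), GG 1 lam a + lam a ≤ x (l + 1) := by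
    intro a; simp [B]
  have hB2 : ∀ a, a ∈ B ↔ ∃ l ∈ Finset.range (k + 1), GG σ lam a + lam a ≤ x (l + 1) := by
    intro a; rw [hB1, hiff]
  have hmono : ∀ τ : Equiv.Perm (Fin m), ∀ a a', τ a ≤ τ a' →
      GG τ lam a + lam a ≤ GG τ lam a' + lam a' := by
    intro τ a a' h
    rcases eq_or_lt_of_le h with e | e
    · rw [τ.injective e]
    · linarith [GG_le τ lam hpos e, hpos a']
  have hd1 : ∀ a a', (1 : Equiv.Perm (Fin m)) a ≤ (1 : Equiv.Perm (Fin m)) a' → a' ∈ B → a ∈ B := by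
    intro a a' h ha
    obtain ⟨l, hl, h'⟩ := (hB1 a').1 ha
    exact (hB1 a).2 ⟨l, hl, (hmono 1 a a' h).trans h'⟩
  have hd2 : ∀ a a', σ a ≤ σ a' → a' ∈ B → a ∈ B := by
    intro a a' h ha
    obtain ⟨l, hl, h'⟩ := (hB2 a').1 ha
    exact (hB2 a).2 ⟨l, hl, (hmono σ a a' h).trans h'⟩
  have hm : 0 < m := j.pos
  have hfirst : (⟨0, hm⟩ : Fin m) ∈ B := by
    rw [hB1]
    refine ⟨k, by simp, ?_⟩
    have ek : x (k + 1) = GG 1 lam j := heq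
    rw [ek]
    exact GG_le 1 lam hpos (show (⟨0, hm⟩ : Fin m) < j from hj)
  have hlast : (⟨m - 1, by omega⟩ : Fin m) ∉ B := by
    rw [hB1]
    rintro ⟨l, -, hl⟩
    rw [GG_last 1 lam hsum (by simp; omega)] at hl
    linarith [(hxI (l + 1)).2]
  apply no_inv hmin hI (s := ∑ a ∈ B, lam a)
  · exact Finset.sum_pos (fun a _ => hpos a) ⟨_, hfirst⟩
  · rw [← hsum]
    exact Finset.sum_lt_sum_of_subset (Finset.subset_univ B) (Finset.mem_univ _) hlast (hpos _)
      (fun a _ _ => (hpos a).le)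
  · intro y hy
    obtain ⟨l, hl⟩ := GG_cover 1 lam hpos hsum hy
    have hl' := iet_image σ lam hpos hl
    rw [hT, GG_downset 1 lam hpos hl B hd1, GG_downset σ lam hpos hl' B hd2]

end dyn

section final
variable {m : ℕ} (σ : Equiv.Perm (Fin m)) (lam : Fin m → ℝ)

theorem rot_of (hpos : ∀ i, 0 < lam i) (hsum : ∑ i, lam i = 1)
    (hd0 : ∀ d : Fin m, (σ d : ℕ) = 0 → (d : ℕ) ≠ 0)
    (H : ∀ a a' : Fin m, (a' : ℕ) = a + 1 → (σ a : ℕ) + 1 ≠ m → (σ a' : ℕ) = σ a + 1) :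
    IsRotationType (ietMap σ lam) := by
  have hm : 0 < m := by
    rcases m with _ | m
    · simp at hsum
    · omega
  set τ : Fin m → ℝ := fun a => GG σ lam a - GG 1 lam a with hτ
  have key : ∀ j : ℕ, ∀ hj : j < m, ∃ z : ℤ, τ ⟨j, hj⟩ = τ ⟨0, hm⟩ + z := by
    intro j
    induction j with
    | zero => intro _; exact ⟨0, by simp⟩
    | succ j ih =>
      intro hj
      obtain ⟨z, hz⟩ := ih (by omega)
      set a : Fin m := ⟨j, by omega⟩ with ha
      set a' : Fin m := ⟨j + 1, hj⟩ with ha'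
      have h1 : GG 1 lam a' = GG 1 lam a + lam a := GG_succ 1 lam (by simp [ha, ha'])
      by_cases hl : (σ a : ℕ) + 1 = m
      · have h2 := GG_last σ lam hsum hl
        have h3 : (σ a' : ℕ) = 0 := by
          set d := σ.symm ⟨0, hm⟩ with hd
          have hσd : (σ d : ℕ) = 0 := by simp [hd]
          have hdne := hd0 d hσd
          set e : Fin m := ⟨(d : ℕ) - 1, by omega⟩ with he
          have : (σ e : ℕ) + 1 = m := by
            by_contra hne
            have := H e d (by simp [he]; omega) hne
            omega
          have hea : e = a := σ.injective (Fin.ext (by omega))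
          have hda : d = a' := by
            apply Fin.ext
            have := congrArg Fin.val hea
            simp only [he, ha, ha'] at this ⊢
            omega
          rw [← hda]; exact hσd
        have h4 := GG_zero σ lam h3
        refine ⟨z - 1, ?_⟩
        simp only [hτ] at hz ⊢
        push_cast
        linarith
      · have h2 := GG_succ σ lam (H a a' (by simp [ha, ha']) hl)
        refine ⟨z, ?_⟩
        simp only [hτ] at hz ⊢
        linarith
  refine ⟨τ ⟨0, hm⟩, fun x hx => ?_⟩
  have hI := (iet_Ico σ lam hpos hsum x).2 hx
  obtain ⟨a, ha⟩ := GG_cover 1 lam hpos hsum hx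
  obtain ⟨z, hz⟩ := key a a.2
  symm
  rw [Int.fract_eq_iff]
  refine ⟨hI.1, hI.2, -z, ?_⟩
  rw [iet_apply σ lam hpos ha]
  simp only [hτ] at hz ⊢
  push_cast
  linarith

theorem exists_special {T : Equiv.Perm ℝ} (hT : ⇑T = ietMap σ lam) (hpos : ∀ i, 0 < lam i)
    (hsum : ∑ i, lam i = 1) (hmin : IsMinimal T) (hrot : ¬ IsRotationType (ietMap σ lam))
    {Φ : Fin m → (ℝ →ₗ[ℚ] ℚ)} (hΦ : ∀ i j, Φ i (lam j) = if i = j then 1 else 0) :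
    ∃ x ∈ Ico (0:ℝ) 1, x ∈ AddSubgroup.closure (range lam) ∧
      (∀ k : ℕ, LC ((T ^ k)⁻¹ : Equiv.Perm ℝ) x) ∧
      (∀ k : ℕ, 1 ≤ k → ¬ LC (T ^ k : Equiv.Perm ℝ) x) := by
  have hm : 0 < m := by
    rcases m with _ | m
    · simp at hsum
    · omega
  have hI : ∀ x, T x ∈ Ico (0:ℝ) 1 ↔ x ∈ Ico (0:ℝ) 1 := fun x => by
    rw [hT]; exact iet_Ico σ lam hpos hsum x
  have hmemG : ∀ a : Fin m, GG 1 lam a ∈ Ico (GG 1 lam a) (GG 1 lam a + lam a) :=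
    fun a => ⟨le_rfl, by linarith [hpos a]⟩
  have hTG : ∀ a, T (GG 1 lam a) = GG σ lam a := fun a => by rw [hT]; exact iet_left σ lam hpos a
  have hGinj : ∀ a b, GG 1 lam a = GG 1 lam b → a = b := by
    intro a b h
    exact GG_uniq 1 lam hpos (hmemG a) (h ▸ hmemG b)
  have hG0 : ∀ a : Fin m, (a : ℕ) = 0 → GG 1 lam a = 0 := fun a h => GG_zero 1 lam (by simpa using h)
  have hd0 : ∀ d : Fin m, (σ d : ℕ) = 0 → (d : ℕ) ≠ 0 := by
    intro d h1 h2
    have h3 := hTG d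
    rw [GG_zero σ lam h1, hG0 d h2] at h3
    have := aperiodic hmin (x := 0) ⟨le_rfl, one_pos⟩ (a₁ := 1) (a₂ := 0) (by simpa using h3)
    omega
  have hpowI : ∀ (k : ℕ) x, (T ^ k) x ∈ Ico (0:ℝ) 1 ↔ x ∈ Ico (0:ℝ) 1 := fun k x => by
    have := zpow_iff (P := fun x => x ∈ Ico (0:ℝ) 1) hI k x
    rwa [zpow_natCast] at this
  have H : ∃ a a' : Fin m, (a' : ℕ) = a + 1 ∧ (σ a : ℕ) + 1 ≠ m ∧ (σ a' : ℕ) ≠ σ a + 1 := by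
    by_contra! H
    exact hrot (rot_of σ lam hpos hsum hd0 H)
  obtain ⟨a, a', haa, hla, hne⟩ := H
  have hxI : GG 1 lam a' ∈ Ico (0:ℝ) 1 := GG_sub 1 lam hpos hsum a' (hmemG a')
  refine ⟨GG 1 lam a', hxI, GG_mem _ _ _, ?_, ?_⟩
  · intro k
    set y := (T ^ k)⁻¹ (GG 1 lam a') with hy
    have hyx : (T ^ k) y = GG 1 lam a' := by simp [hy]
    have hyI : y ∈ Ico (0:ℝ) 1 := by rw [← hpowI k, hyx]; exact hxI
    rw [← hyx]
    apply LC.inv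
    apply LC_pow
    intro l hl
    rw [hT]
    apply iet_LC_of_ne σ lam hpos hsum ((hpowI l y).2 hyI)
    intro i hi
    apply idoc σ lam hT hpos hsum hmin hΦ i a' (by omega) (k - l - 1)
    rw [← hi, ← Equiv.Perm.mul_apply, ← pow_add, ← hyx]
    congr 2
    omega
  · intro k hk hLC
    obtain ⟨k, rfl⟩ : ∃ k', k = k' + 1 := ⟨k - 1, by omega⟩
    have hσa := (σ a).2
    set c : Fin m := σ.symm ⟨σ a + 1, by omega⟩ with hc
    have hσc : (σ c : ℕ) = σ a + 1 := by simp [hc]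
    have hca : c ≠ a' := by
      intro h
      rw [h] at hσc
      exact hne hσc
    have hGc := GG_succ σ lam hσc
    have hGa : GG 1 lam a' = GG 1 lam a + lam a := GG_succ 1 lam (by simpa using haa)
    have hw : LC (T ^ k : Equiv.Perm ℝ) (T (GG 1 lam c)) := by
      apply LC_pow
      intro l hl
      rw [← Equiv.Perm.mul_apply, ← pow_succ, hT]
      apply iet_LC_of_ne σ lam hpos hsum
        ((hpowI (l + 1) _).2 (GG_sub 1 lam hpos hsum c (hmemG c)))
      intro i hi
      by_cases hi0 : (i : ℕ) = 0
      · rw [hG0 i hi0] at hi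
        rcases l with _ | l
        · rw [zero_add, pow_one, hTG, hGc] at hi
          linarith [GG_nonneg σ lam hpos a, hpos a]
        · set d := σ.symm ⟨0, hm⟩ with hd
          have hσd : (σ d : ℕ) = 0 := by simp [hd]
          have hTd : T (GG 1 lam d) = 0 := by rw [hTG, GG_zero σ lam hσd]
          rw [← hTd, pow_succ', Equiv.Perm.mul_apply] at hi
          have hi' := T.injective hi
          have := hd0 d hσd
          exact idoc σ lam hT hpos hsum hmin hΦ c d (by omega) l hi'
      · exact idoc σ lam hT hpos hsum hmin hΦ c i (by omega) l hi
    obtain ⟨d1, hd1, h1⟩ := hLC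
    obtain ⟨d2, hd2, h2⟩ := hw
    obtain ⟨ε, he0, he⟩ := exists_between (lt_min (lt_min hd1 hd2) (hpos a))
    have l1 := he.trans_le ((min_le_left _ _).trans (min_le_left _ _))
    have l2 := he.trans_le ((min_le_left _ _).trans (min_le_right _ _))
    have l3 := he.trans_le (min_le_right _ _)
    have e1 := h1 ε he0 l1
    have e2 := h2 ε he0 l2
    have e3 : T (GG 1 lam a' - ε) = T (GG 1 lam c) - ε := by
      rw [hTG, hT, iet_apply σ lam hpos (a := a) ⟨by linarith, by linarith⟩]
      linarith
    rw [pow_succ, Equiv.Perm.mul_apply, Equiv.Perm.mul_apply, e3, e2] at e1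
    have e4 : (T ^ k) (T (GG 1 lam c)) = (T ^ k) (T (GG 1 lam a')) := by linarith
    exact hca (hGinj _ _ (T.injective ((T ^ k).injective e4)))

theorem main_aux {S T : Equiv.Perm ℝ} (hT : ⇑T = ietMap σ lam) (hpos : ∀ i, 0 < lam i)
    (hsum : ∑ i, lam i = 1) (hindep : LinearIndependent ℚ lam) (hmin : IsMinimal T)
    (hrot : ¬ IsRotationType (ietMap σ lam)) {n : ℕ} (hn : 2 ≤ n) (hST : S ^ n = T)
    {k : ℕ} {β c : ℕ → ℝ} (hD : Data S k β c)
    (hSI : ∀ x, S x ∈ Ico (0:ℝ) 1 ↔ x ∈ Ico (0:ℝ) 1) : False := by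
  obtain ⟨Φ, hΦ⟩ := exists_dual lam hindep
  set L := AddSubgroup.closure (range lam) with hL
  have hTL : ∀ x, T x - x ∈ L := fun x => by rw [hT]; exact iet_sub_mem σ lam hpos hsum x
  have hLC : ∀ x, x ∉ L → LC T x := fun x hx => by rw [hT]; exact iet_LC σ lam hpos hsum hx
  have hcomm : Commute S T := by rw [← hST]; exact Commute.self_pow S n
  have hF : (β '' (Set.Iic k)).Finite := (Set.finite_Iic k).image β
  have hSF : ∀ x, x ∉ β '' (Set.Iic k) → LC S x := fun x hx => hD.LC hx
  obtain ⟨x, hxI, hxL, hback, hforw⟩ := exists_special σ lam hT hpos hsum hmin hrot hΦ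
  have hSx := S_special_mem hcomm hTL hLC hF hSF (aperiodic hmin hxI) hback hforw
  have hcL : ∀ i < k, c i ∈ L := by
    intro i hi
    have hlt := hD.lt i hi
    have hmid : (β i + β (i + 1)) / 2 ∈ Ioo (β i) (β (i + 1)) := ⟨by linarith, by linarith⟩
    have hmidI : (β i + β (i + 1)) / 2 ∈ unitI := hD.sub hi ⟨hmid.1.le, hmid.2⟩
    obtain ⟨y, hy, hyo⟩ := mem_closure_iff.1 (hmin x hxI hmidI) _ isOpen_Ioo hmid
    obtain ⟨j, rfl⟩ := mem_orbit hyo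
    have h1 := hSx j
    have h2 : (T ^ j) x ∈ L := (mem_pow_iff hTL j x).2 hxL
    rw [hD.tr i hi _ ⟨hy.1.le, hy.2⟩] at h1
    simpa using L.sub_mem h1 h2
  have hSL : ∀ x, S x - x ∈ L := by
    intro y
    by_cases hy : y ∈ Ico (0:ℝ) 1
    · obtain ⟨i, hi, hyi⟩ := hD.cover hy
      rw [hD.tr i hi y hyi, add_sub_cancel_left]
      exact hcL i hi
    · rw [hD.out y hy, sub_self]
      exact L.zero_mem
  have hbr : ∀ i, i + 1 < k → β (i + 1) ∈ L ∨ c (i + 1) = c i := by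
    intro i hi
    by_cases h : β (i + 1) ∈ L
    · exact Or.inl h
    · right
      have hbI : β (i + 1) ∈ Ico (0:ℝ) 1 := hD.sub hi ⟨le_rfl, hD.lt _ hi⟩
      exact hD.const_eq hi (S_LC hcomm hTL hLC hF hSF hSL (aperiodic hmin hbI) h)
  have hΩ : ∀ i a : Fin m, Φ i (GG σ lam a - GG 1 lam a) = 0 := by
    intro i a
    obtain ⟨hint, hval⟩ := hD.integral (Φ i)
    have hpow := integral_pow_sum S hD.mp hSI (Φ i) n hint
    rw [hST, hT, iet_integral σ lam hpos hsum, hval] at hpow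
    have hv : ∀ j, ∃ z : ℤ, j < k → Φ i (c j) = z := by
      intro j
      by_cases hj : j < k
      · obtain ⟨z, hz⟩ := dual_int lam hΦ i (hcL j hj)
        exact ⟨z, fun _ => hz⟩
      · exact ⟨0, fun h => absurd h hj⟩
    choose v hv using hv
    have hq := abel_mem L β v hD.zero k (fun j hj => by
      rcases hbr j hj with h | h
      · exact Or.inl h
      · right
        have h1 := hv (j + 1) hj
        rw [h, hv j (by omega)] at h1
        exact_mod_cast h1.symm) (by rw [hD.last]; exact one_mem lam hsum)
    have hqe : ∑ j ∈ Finset.range k, (Φ i (c j) : ℝ) * (β (j + 1) - β j)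
        = ∑ j ∈ Finset.range k, (v j : ℝ) * (β (j + 1) - β j) := by
      refine Finset.sum_congr rfl fun j hj => ?_
      rw [hv j (Finset.mem_range.1 hj)]
      norm_cast
    rw [hqe] at hpow
    set q := ∑ j ∈ Finset.range k, (v j : ℝ) * (β (j + 1) - β j) with hqdef
    obtain ⟨z, hz⟩ := dual_int lam hΦ a hq
    have happ := congrArg (Φ a) hpow
    have hl : Φ a (∑ b, (Φ i (GG σ lam b - GG 1 lam b) : ℝ) * lam b)
        = Φ i (GG σ lam a - GG 1 lam a) := by
      rw [map_sum]
      have : ∀ b, Φ a ((Φ i (GG σ lam b - GG 1 lam b) : ℝ) * lam b)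
          = if a = b then Φ i (GG σ lam b - GG 1 lam b) else 0 := by
        intro b
        rw [← Rat.smul_def, map_smul, hΦ]
        simp
      simp only [this]
      simp
    have hr : Φ a ((n : ℝ) * q) = n * z := by
      rw [← nsmul_eq_mul, map_nsmul, hz, nsmul_eq_mul]
    rw [hl, hr] at happ
    rw [happ]
    have hzz : (n : ℤ) * z = (if σ i < σ a then 1 else 0) - (if i < a then 1 else 0) := by
      have h2 := happ
      rw [map_sub, dual_GG σ lam hΦ, dual_GG 1 lam hΦ] at h2
      simp only [Equiv.Perm.one_apply] at h2
      have h3 : ((n : ℤ) : ℚ) * z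
          = (((if σ i < σ a then 1 else 0) - (if i < a then 1 else 0) : ℤ) : ℚ) := by
        push_cast
        exact h2.symm
      exact_mod_cast h3
    have hz0 : z = 0 := by
      by_contra hz0
      have hn' : (2:ℤ) ≤ n := by exact_mod_cast hn
      have habs : |(n : ℤ) * z| ≤ 1 := by
        rw [hzz]
        split_ifs <;> simp
      rw [abs_mul, abs_of_nonneg (by omega : (0:ℤ) ≤ n)] at habs
      have := Int.one_le_abs hz0
      nlinarith
    simp [hz0]
  apply hrot
  refine ⟨0, fun y hy => ?_⟩
  rw [add_zero, Int.fract_eq_self.2 ⟨hy.1, hy.2⟩]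
  obtain ⟨a, ha⟩ := GG_cover 1 lam hpos hsum hy
  rw [iet_apply σ lam hpos ha]
  have : GG σ lam a = GG 1 lam a := by
    unfold GG
    refine Finset.sum_congr ?_ fun _ _ => rfl
    ext i
    simp only [Finset.mem_filter, Finset.mem_univ, true_and]
    have h := hΩ i a
    rw [map_sub, dual_GG σ lam hΦ, dual_GG 1 lam hΦ] at h
    by_cases h1 : σ i < σ a <;> by_cases h2 : (1 : Equiv.Perm (Fin m)) i < (1 : Equiv.Perm (Fin m)) a
    · exact iff_of_true h1 h2
    · rw [if_pos h1, if_neg h2] at h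
      norm_num at h
    · rw [if_neg h1, if_pos h2] at h
      norm_num at h
    · exact iff_of_false h1 h2
  rw [this]
  ring

end final

theorem iet_bij {S : ℝ → ℝ} (h : IsIET S) :
    Function.Bijective S ∧ ∀ x, S x ∈ Ico (0:ℝ) 1 ↔ x ∈ Ico (0:ℝ) 1 := by
  obtain ⟨hb, hout, -⟩ := h
  have hI : ∀ x, S x ∈ Ico (0:ℝ) 1 ↔ x ∈ Ico (0:ℝ) 1 := by
    intro x
    constructor
    · intro h
      by_contra hx
      rw [hout x hx] at h
      exact hx h
    · intro hx
      exact hb.mapsTo hx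
  refine ⟨⟨?_, ?_⟩, hI⟩
  · intro x y hxy
    by_cases hx : x ∈ Ico (0:ℝ) 1
    · have hy : y ∈ Ico (0:ℝ) 1 := by rw [← hI, ← hxy, hI]; exact hx
      exact hb.injOn hx hy hxy
    · have hy : y ∉ Ico (0:ℝ) 1 := by rw [← hI, ← hxy, hI]; exact hx
      rwa [hout x hx, hout y hy] at hxy
  · intro y
    by_cases hy : y ∈ Ico (0:ℝ) 1
    · obtain ⟨x, _, hx⟩ := hb.surjOn hy
      exact ⟨x, hx⟩
    · exact ⟨y, hout y hy⟩

/-- A minimal IET which is not of rotation type and whose interval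
lengths are linearly independent over ℚ has no n-th root in 𝔾 for any n ≥ 2. -/
theorem stmt0 {m : ℕ} (π : Equiv.Perm (Fin m)) (lam : Fin m → ℝ)
    (hpos : ∀ i, 0 < lam i) (hsum : ∑ i, lam i = 1)
    (hindep : LinearIndependent ℚ lam)
    (hmin : IsMinimal (ietMap π lam))
    (hrot : ¬ IsRotationType (ietMap π lam)) :
    ¬ HasNontrivialRoot (ietMap π lam) := by
  rintro ⟨S, n, hS, hn, hST⟩
  obtain ⟨hb, hSI⟩ := iet_bij hS
  obtain ⟨k, β, c, hD⟩ := exists_data hS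
  let S' : Equiv.Perm ℝ := Equiv.ofBijective S hb
  have hT : ⇑(S' ^ n) = ietMap π lam := by
    rw [← Equiv.Perm.iterate_eq_pow]
    exact hST
  exact main_aux π lam (S := S') (T := S' ^ n) hT hpos hsum hindep (by rw [hT]; exact hmin) hrot hn rfl
    (k := k) (β := β) (c := c) hD hSI

end IETRoots
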